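/- arXiv:2105.05770 — 3 statements merged into one kernel-verified Lean document; each statement's English description precedes it below -/
import Mathlib

section
/- Let λ = exp(2πi/12) ∈ ℂ (a primitive 12-th root of unity). Then λ^0 + λ^3 + λ^4 + λ^8 + λ^9 = 0. In particular, a sum of 5 distinct 12-th roots of unity can vanish even though 5 is coprime to 12, so the hypothesis |J| ≤ 4 in the non-prime case of Remark 2.5 cannot be dropped. -/
/-- The twelfth cyclotomic polynomial vanishes at a primitive twelfth root of unity. -/
theorem IsPrimitiveRoot.pow_four_sub_sq_add_one_eq_zero {R : Type*} [CommRing R] [IsDomain R]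
    {ζ : R} (h : IsPrimitiveRoot ζ 12) : ζ ^ 4 - ζ ^ 2 + 1 = 0 := by
  have h6 : ζ ^ 6 - 1 ≠ 0 := sub_ne_zero.mpr (h.pow_ne_one_of_pos_of_lt (by norm_num) (by norm_num))
  have h4 : ζ ^ 4 - 1 ≠ 0 := sub_ne_zero.mpr (h.pow_ne_one_of_pos_of_lt (by norm_num) (by norm_num))
  refine (mul_eq_zero.mp ?_).resolve_left (mul_ne_zero h6 h4)
  linear_combination (ζ ^ 2 - 1) * h.pow_eq_one

open Complex in
theorem stmt_2 (ζ : ℂ) (hζ : ζ = Complex.exp (2 * Real.pi * Complex.I / 12)) :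
    ζ ^ 0 + ζ ^ 3 + ζ ^ 4 + ζ ^ 8 + ζ ^ 9 = 0 := by
  have h : IsPrimitiveRoot ζ 12 := by
    rw [hζ]
    exact_mod_cast Complex.isPrimitiveRoot_exp 12 (by norm_num)
  linear_combination
    (1 + (ζ ^ 2 + ζ ^ 3) * (ζ ^ 2 + 1)) * h.pow_four_sub_sq_add_one_eq_zero
end

section
/- Let k ≥ 1 and let (a_i, b_i) ∈ ℂ × ℂ for i = 1, …, k be pairwise distinct pairs. Then the set of pairs (α, β) ∈ ℂ × ℂ such that α ≠ a_i and β ≠ b_i for all i, and such that the arguments arg((β − b_i)/(α − a_i)) (i = 1, …, k) are pairwise distinct, is dense in ℂ × ℂ. -/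
open ComplexConjugate in
/-- The complement of a (possibly degenerate) circle or line in the complex plane is dense. -/
theorem dense_setOf_im_mul_sub_mul_conj_sub_ne_zero {c a a' : ℂ} (hc : c ≠ 0) (ha : a ≠ a') :
    Dense {z : ℂ | (c * ((z - a) * conj (z - a'))).im ≠ 0} := by
  rw [Metric.dense_iff]
  intro w r hr
  by_contra hne
  have hzero : ∀ h : ℂ, ‖h‖ < r → (c * ((w + h - a) * conj (w + h - a'))).im = 0 := by
    intro h hh
    by_contra hn
    exact hne ⟨w + h, by simpa using hh, hn⟩
  obtain ⟨ε, hε, hεr⟩ := exists_between hr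
  have habs : |ε| < r := by rwa [abs_of_pos hε]
  have h0 := hzero 0 (by simpa using hr)
  have h1 := hzero (ε : ℂ) (by simpa using habs)
  have h2 := hzero (-(ε : ℂ)) (by simpa using habs)
  have h3 := hzero (ε * Complex.I) (by simpa using habs)
  have h4 := hzero (-(ε * Complex.I)) (by simpa using habs)
  simp only [Complex.mul_im, Complex.mul_re, Complex.sub_re, Complex.sub_im, Complex.add_re,
    Complex.add_im, Complex.neg_re, Complex.neg_im, Complex.conj_re, Complex.conj_im,
    Complex.ofReal_re, Complex.ofReal_im, Complex.I_re, Complex.I_im, Complex.zero_re,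
    Complex.zero_im] at h0 h1 h2 h3 h4
  -- The second difference of the quadratic function isolates its leading coefficient.
  have him : c.im = 0 := by
    have : ε ^ 2 * c.im = 0 := by linear_combination (h1 + h2 - 2 * h0) / 2
    simpa [hε.ne'] using this
  have hre : c.re ≠ 0 := fun h => hc (Complex.ext h him)
  simp only [him] at h1 h2 h3 h4
  have hii : a.im = a'.im := by
    have : ε * c.re * (a.im - a'.im) = 0 := by linear_combination (h2 - h1) / 2
    simpa [hε.ne', hre, sub_eq_zero] using this
  have hrr : a.re = a'.re := by
    have : ε * c.re * (a.re - a'.re) = 0 := by linear_combination (h3 - h4) / 2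
    simpa [hε.ne', hre, sub_eq_zero] using this
  exact ha (Complex.ext hrr hii)

theorem Dense.of_dense_slices {X Y : Type*} [TopologicalSpace X] [TopologicalSpace Y]
    {s : Set (X × Y)} {t : Set Y} (ht : Dense t) (hs : ∀ y ∈ t, Dense {x | (x, y) ∈ s}) :
    Dense s := by
  rw [dense_iff_inter_open]
  rintro W hW ⟨⟨x, y⟩, hxy⟩
  obtain ⟨U, V, hU, hV, hx, hy, hUV⟩ := isOpen_prod_iff.mp hW x y hxy
  obtain ⟨y', hy'V, hy't⟩ := ht.inter_open_nonempty V hV ⟨y, hy⟩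
  obtain ⟨x', hx'U, hx's⟩ := (hs y' hy't).inter_open_nonempty U hU ⟨x, hx⟩
  exact ⟨(x', y'), hUV ⟨hx'U, hy'V⟩, hx's⟩

open ComplexConjugate in
theorem dense_setOf_im_cross_ratio_ne_zero {a a' b b' : ℂ} (h : (a, b) ≠ (a', b')) :
    Dense {p : ℂ × ℂ |
      (((p.2 - b) * conj (p.2 - b')) * ((p.1 - a') * conj (p.1 - a))).im ≠ 0} := by
  have hpair : ∀ u v : ℂ, Dense ({u, v}ᶜ : Set ℂ) := fun u v =>
    ((Set.toFinite {u, v}).countable).dense_compl ℝ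
  by_cases ha : a = a'
  · have hb : b ≠ b' := fun hb => h (by rw [ha, hb])
    have hswap : Dense {q : ℂ × ℂ |
        (((q.1 - b) * conj (q.1 - b')) * ((q.2 - a') * conj (q.2 - a))).im ≠ 0} := by
      refine (hpair a a').of_dense_slices fun α hα => ?_
      simp only [Set.mem_compl_iff, Set.mem_insert_iff, Set.mem_singleton_iff, not_or] at hα
      have hc : (α - a') * conj (α - a) ≠ 0 := by simp [sub_eq_zero, hα, -map_sub]
      refine (dense_setOf_im_mul_sub_mul_conj_sub_ne_zero hc hb).mono fun β hβ => ?_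
      rwa [Set.mem_ofPred_eq, mul_comm] at hβ
    exact (hswap.preimage (Homeomorph.prodComm ℂ ℂ).isOpenMap).mono fun p hp => hp
  · refine (hpair b b').of_dense_slices fun β hβ => ?_
    simp only [Set.mem_compl_iff, Set.mem_insert_iff, Set.mem_singleton_iff, not_or] at hβ
    have hc : (β - b) * conj (β - b') ≠ 0 := by simp [sub_eq_zero, hβ, -map_sub]
    exact dense_setOf_im_mul_sub_mul_conj_sub_ne_zero hc (Ne.symm ha)

open ComplexConjugate in
theorem im_mul_conj_mul_eq_zero_of_arg_div_eq {x x' y y' : ℂ} (hx : x ≠ 0) (hx' : x' ≠ 0)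
    (hy : y ≠ 0) (hy' : y' ≠ 0) (h : Complex.arg (y / x) = Complex.arg (y' / x')) :
    ((y * conj y') * (x' * conj x)).im = 0 := by
  rw [Complex.arg_eq_arg_iff (div_ne_zero hy hx) (div_ne_zero hy' hx'), ← Complex.ofReal_div] at h
  set r : ℝ := ‖y' / x'‖ / ‖y / x‖
  have hmul : y' * x = r * (y * x') := by
    field_simp at h
    linear_combination -h
  have hreal : (y * conj y') * (x' * conj x) = ((r * Complex.normSq (y * x') : ℝ) : ℂ) := by
    have hconj := congrArg conj hmul
    simp only [map_mul, Complex.conj_ofReal] at hconj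
    push_cast
    rw [Complex.normSq_eq_conj_mul_self, map_mul]
    linear_combination (y * x') * hconj
  rw [hreal, Complex.ofReal_im]

theorem stmt_3 (k : ℕ) (hk : 1 ≤ k) (a b : Fin k → ℂ)
    (hdist : ∀ i j : Fin k, i ≠ j → (a i, b i) ≠ (a j, b j)) :
    Dense {p : ℂ × ℂ | (∀ i, p.1 ≠ a i ∧ p.2 ≠ b i) ∧
      ∀ i j : Fin k, i ≠ j →
        Complex.arg ((p.2 - b i) / (p.1 - a i)) ≠
        Complex.arg ((p.2 - b j) / (p.1 - a j))} := by
  have havoid : Dense (⋂ i, ({a i}ᶜ : Set ℂ) ×ˢ ({b i}ᶜ : Set ℂ)) :=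
    dense_iInter_of_isOpen (fun i => isOpen_compl_singleton.prod isOpen_compl_singleton)
      fun i => (dense_compl_singleton (a i)).prod (dense_compl_singleton (b i))
  have hopen : ∀ q : {q : Fin k × Fin k // q.1 ≠ q.2}, IsOpen {p : ℂ × ℂ |
      (((p.2 - b q.1.1) * (starRingEnd ℂ) (p.2 - b q.1.2)) *
        ((p.1 - a q.1.2) * (starRingEnd ℂ) (p.1 - a q.1.1))).im ≠ 0} := fun q =>
    isOpen_ne_fun (by fun_prop) continuous_const
  have hcross := dense_iInter_of_isOpen hopen fun q =>
    dense_setOf_im_cross_ratio_ne_zero (hdist _ _ q.2)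
  refine (havoid.inter_of_isOpen_right hcross ?_).mono ?_
  · exact isOpen_iInter_of_finite hopen
  · rintro p ⟨hp, hpq⟩
    have hne : ∀ i, p.1 ≠ a i ∧ p.2 ≠ b i := fun i => by simpa using Set.mem_iInter.mp hp i
    refine ⟨hne, fun i j hij harg => Set.mem_iInter.mp hpq ⟨(i, j), hij⟩ ?_⟩
    exact im_mul_conj_mul_eq_zero_of_arg_div_eq (sub_ne_zero.mpr (hne i).1)
      (sub_ne_zero.mpr (hne j).1) (sub_ne_zero.mpr (hne i).2) (sub_ne_zero.mpr (hne j).2) harg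
end

section
/- Let n ≥ 1 and let f be a homogeneous polynomial of degree d ≥ 1 in n complex variables. Let F = {x ∈ ℂ^n : f(x) = 1} (every such x is nonzero since f(0) = 0), and let q : F → ℙ^{n−1}(ℂ) be the map sending x to its class [x] in the projectivization of ℂ^n. Then: (i) the range of q consists exactly of those points of ℙ^{n−1}(ℂ) represented by vectors v with f(v) ≠ 0; (ii) the corestriction of q to its range is a covering map; and (iii) every fiber of q has exactly d elements. -/
open MvPolynomial

/-- The projectivization of `ℂ^n` with its quotient topology. -/
noncomputable instance {n : ℕ} : TopologicalSpace (Projectivization ℂ (Fin n → ℂ)) :=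
  inferInstanceAs (TopologicalSpace (Quotient (projectivizationSetoid ℂ (Fin n → ℂ))))

/-- If `f` is homogeneous of degree `d ≥ 1` and `f(x) = 1`, then `x ≠ 0`
(indeed `f(0) = 0`). -/
theorem ne_zero_of_eval_eq_one {n d : ℕ} (hd : 1 ≤ d) {f : MvPolynomial (Fin n) ℂ}
    (hf : f.IsHomogeneous d) {x : Fin n → ℂ} (hx : eval x f = 1) : x ≠ 0 := by
  intro h0
  subst h0
  rw [eval_zero, constantCoeff_eq] at hx
  rw [hf.coeff_eq_zero (d := 0) (by simp; omega)] at hx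
  exact one_ne_zero hx.symm

/-- A homogeneous polynomial of degree `d` scales by `c ^ d` under dilation by `c`. -/
theorem MvPolynomial.IsHomogeneous.eval_smul {σ R : Type*} [CommSemiring R] {d : ℕ}
    {f : MvPolynomial σ R} (hf : f.IsHomogeneous d) (c : R) (x : σ → R) :
    eval (c • x) f = c ^ d * eval x f := by
  simp_rw [eval_eq, Finset.mul_sum]
  refine Finset.sum_congr rfl fun m hm => ?_
  have hdeg : ∑ i ∈ m.support, m i = d := by
    rw [← Finsupp.degree_apply, Finsupp.degree_eq_weight_one]
    exact hf (mem_support_iff.mp hm)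
  simp only [Pi.smul_apply, smul_eq_mul, mul_pow, Finset.prod_mul_distrib,
    Finset.prod_pow_eq_pow_sum, hdeg]
  ring

/-- The `d`-th roots of unity act by scalar multiplication on the affine Milnor fiber `f = 1` of a
homogeneous polynomial `f` of degree `d`. -/
abbrev rootsOfUnityMulAction {σ : Type*} {d : ℕ} {f : MvPolynomial σ ℂ}
    (hf : f.IsHomogeneous d) : MulAction (rootsOfUnity d ℂ) {x : σ → ℂ // eval x f = 1} where
  smul ζ x := ⟨((ζ : ℂˣ) : ℂ) • x.1, by
    rw [hf.eval_smul, x.2, mul_one, ← Units.val_pow_eq_pow_val,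
      (mem_rootsOfUnity _ _).mp ζ.2, Units.val_one]⟩
  one_smul x := Subtype.ext (one_smul ℂ x.1)
  mul_smul ζ ξ x := Subtype.ext (mul_smul ((ζ : ℂˣ) : ℂ) ((ξ : ℂˣ) : ℂ) x.1)

/-- A subset of `ℙ^{n-1}(ℂ)` is open as soon as the set of nonzero vectors representing its points
is open. -/
theorem Projectivization.isOpen_of_isOpen_preimage_mk {n : ℕ}
    {s : Set (Projectivization ℂ (Fin n → ℂ))}
    (hs : IsOpen {v : {v : Fin n → ℂ // v ≠ 0} | Projectivization.mk ℂ v.1 v.2 ∈ s}) :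
    IsOpen s :=
  hs

theorem Projectivization.continuous_mk {n : ℕ} :
    Continuous fun v : {v : Fin n → ℂ // v ≠ 0} => Projectivization.mk ℂ v.1 v.2 :=
  continuous_coinduced_rng

section MilnorFiber

variable {n d : ℕ} {f : MvPolynomial (Fin n) ℂ}

/-- Near a vector `v` with `a • v` on the fiber `f = 1`, the scalar `a` extends to a continuous
function rescaling vectors onto that fiber. -/
theorem exists_local_rescaling (hd : 1 ≤ d) (hf : f.IsHomogeneous d) {v : Fin n → ℂ} {a : ℂ}
    (hav : eval (a • v) f = 1) :
    ∃ s : (Fin n → ℂ) → ℂ, ContinuousAt s v ∧ s v = a ∧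
      ∀ᶠ w in nhds v, eval (s w • w) f = 1 := by
  rw [hf.eval_smul] at hav
  have hv : eval v f ≠ 0 := right_ne_zero_of_mul_eq_one hav
  have hcont : Continuous fun w => eval w f := MvPolynomial.continuous_eval f
  have hd0 : d ≠ 0 := by omega
  refine ⟨fun w => a * (eval v f / eval w f) ^ ((d : ℂ)⁻¹), ?_, ?_, ?_⟩
  · refine continuousAt_const.mul (ContinuousAt.cpow ?_ continuousAt_const ?_)
    · exact continuousAt_const.div hcont.continuousAt hv
    · rw [div_self hv]
      exact Complex.one_mem_slitPlane
  · simp [div_self hv]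
  · filter_upwards [hcont.continuousAt.eventually_ne hv] with w hw
    rw [hf.eval_smul, mul_pow, Complex.cpow_nat_inv_pow _ hd0, mul_assoc, div_mul_cancel₀ _ hw, hav]

variable {q : {x : Fin n → ℂ // eval x f = 1} → Projectivization ℂ (Fin n → ℂ)}

theorem continuous_milnorFiber_mk (hd : 1 ≤ d) (hf : f.IsHomogeneous d)
    (hq : ∀ x, q x = Projectivization.mk ℂ x.1 (ne_zero_of_eval_eq_one hd hf x.2)) :
    Continuous q := by
  rw [funext hq]
  exact Projectivization.continuous_mk.comp
    (continuous_subtype_val.subtype_mk fun x => ne_zero_of_eval_eq_one hd hf x.2)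

theorem isOpenMap_milnorFiber_mk (hd : 1 ≤ d) (hf : f.IsHomogeneous d)
    (hq : ∀ x, q x = Projectivization.mk ℂ x.1 (ne_zero_of_eval_eq_one hd hf x.2)) :
    IsOpenMap q := by
  rintro _ ⟨O, hO, rfl⟩
  refine Projectivization.isOpen_of_isOpen_preimage_mk (isOpen_iff_mem_nhds.mpr ?_)
  rintro ⟨v, hv⟩ ⟨x, hxO, hx⟩
  rw [hq, Projectivization.mk_eq_mk_iff'] at hx
  obtain ⟨a, hax⟩ := hx
  obtain ⟨s, hs, hsv, hs1⟩ := exists_local_rescaling hd hf (hax ▸ x.2 : eval (a • v) f = 1)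
  have hmem : ∀ᶠ w in nhds v, s w • w ∈ O :=
    (hs.smul continuousAt_id).eventually_mem (hO.mem_nhds (by simpa [hsv, hax] using hxO))
  filter_upwards [continuous_subtype_val.continuousAt.eventually (hs1.and hmem)] with w hw
  refine ⟨⟨s w.1 • w.1, hw.1⟩, hw.2, ?_⟩
  rw [hq, Projectivization.mk_eq_mk_iff']
  exact ⟨s w.1, rfl⟩

theorem range_milnorFiber_mk (hd : 1 ≤ d) (hf : f.IsHomogeneous d)
    (hq : ∀ x, q x = Projectivization.mk ℂ x.1 (ne_zero_of_eval_eq_one hd hf x.2)) :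
    Set.range q = {p : Projectivization ℂ (Fin n → ℂ) |
      ∃ (v : Fin n → ℂ) (hv : v ≠ 0), Projectivization.mk ℂ v hv = p ∧ eval v f ≠ 0} := by
  ext p
  constructor
  · rintro ⟨x, rfl⟩
    exact ⟨x.1, ne_zero_of_eval_eq_one hd hf x.2, (hq x).symm, by simp [x.2]⟩
  · rintro ⟨v, hv, rfl, hfv⟩
    obtain ⟨a, ha⟩ := IsAlgClosed.exists_pow_nat_eq (eval v f)⁻¹ hd
    refine ⟨⟨a • v, by rw [hf.eval_smul, ha, inv_mul_cancel₀ hfv]⟩, ?_⟩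
    rw [hq, Projectivization.mk_eq_mk_iff']
    exact ⟨a, rfl⟩

/-- The projection of the Milnor fiber to projective space is, over its image, the quotient
covering by the group of `d`-th roots of unity. -/
theorem isQuotientCoveringMap_milnorFiber_mk (hd : 1 ≤ d) (hf : f.IsHomogeneous d)
    (hq : ∀ x, q x = Projectivization.mk ℂ x.1 (ne_zero_of_eval_eq_one hd hf x.2)) :
    letI := rootsOfUnityMulAction hf
    IsQuotientCoveringMap (Set.rangeFactorization q) (rootsOfUnity d ℂ) := by
  let := rootsOfUnityMulAction hf
  have smul_val (ζ : rootsOfUnity d ℂ) (x : {x : Fin n → ℂ // eval x f = 1}) :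
      (ζ • x).1 = ((ζ : ℂˣ) : ℂ) • x.1 := rfl
  have : NeZero d := ⟨by omega⟩
  have : ContinuousConstSMul (rootsOfUnity d ℂ) {x : Fin n → ℂ // eval x f = 1} :=
    ⟨fun ζ => (continuous_subtype_val.const_smul ((ζ : ℂˣ) : ℂ)).subtype_mk _⟩
  have : IsCancelSMul (rootsOfUnity d ℂ) {x : Fin n → ℂ // eval x f = 1} :=
    { right_cancel' := fun ζ ξ x h => Subtype.ext <| Units.ext <|
        smul_left_injective ℂ (ne_zero_of_eval_eq_one hd hf x.2) (congrArg Subtype.val h) }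
  have : LocallyCompactSpace {x : Fin n → ℂ // eval x f = 1} :=
    (isClosed_eq (MvPolynomial.continuous_eval f) continuous_const).locallyCompactSpace
  have hquot : Topology.IsQuotientMap (Set.rangeFactorization q) :=
    ((isOpenMap_milnorFiber_mk hd hf hq).subtype_mk Set.mem_range_self).isQuotientMap
      ((continuous_milnorFiber_mk hd hf hq).subtype_mk Set.mem_range_self)
      Set.rangeFactorization_surjective
  refine hquot.isQuotientCoveringMap_of_properlyDiscontinuousSMul fun {x y} => ?_
  rw [Subtype.ext_iff, Set.rangeFactorization_coe, Set.rangeFactorization_coe, hq, hq,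
    Projectivization.mk_eq_mk_iff, MulAction.mem_orbit_iff]
  constructor
  · rintro ⟨a, ha⟩
    have had : (a : ℂ) ^ d = 1 := by
      have h := hf.eval_smul (a : ℂ) y.1
      rwa [show (a : ℂ) • y.1 = x.1 from ha, x.2, y.2, mul_one, eq_comm] at h
    exact ⟨⟨a, (mem_rootsOfUnity' _ _).mpr had⟩, Subtype.ext ha⟩
  · rintro ⟨ζ, rfl⟩
    exact ⟨ζ, (smul_val ζ y).symm⟩

end MilnorFiber

theorem stmt_5 (n d : ℕ) (hn : 1 ≤ n) (hd : 1 ≤ d) (f : MvPolynomial (Fin n) ℂ)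
    (hf : f.IsHomogeneous d)
    (q : {x : Fin n → ℂ // eval x f = 1} → Projectivization ℂ (Fin n → ℂ))
    (hq : ∀ x, q x = Projectivization.mk ℂ x.1 (ne_zero_of_eval_eq_one hd hf x.2)) :
    -- (i) the range of `q` consists exactly of the points represented by
    -- vectors `v` with `f(v) ≠ 0`
    (Set.range q = {p : Projectivization ℂ (Fin n → ℂ) |
        ∃ (v : Fin n → ℂ) (hv : v ≠ 0), Projectivization.mk ℂ v hv = p ∧ eval v f ≠ 0}) ∧
    -- (ii) the corestriction of `q` to its range is a covering map
    IsCoveringMap (Set.rangeFactorization q) ∧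
    -- (iii) every fiber of `q` has exactly `d` elements
    (∀ p : Set.range q, Nat.card {x // Set.rangeFactorization q x = p} = d) := by
  let := rootsOfUnityMulAction hf
  have hcov := isQuotientCoveringMap_milnorFiber_mk hd hf hq
  have : NeZero d := ⟨by omega⟩
  refine ⟨range_milnorFiber_mk hd hf hq, hcov.isCoveringMap, fun p => ?_⟩
  obtain ⟨x, hx⟩ := Set.rangeFactorization_surjective p
  exact (Nat.card_congr (hcov.fiberEquivGroup ⟨x, hx⟩)).trans
    (HasEnoughRootsOfUnity.natCard_rootsOfUnity ℂ d)
end
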